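/- Let z be an even integer with z ≡ 3 (mod 7). Set α = 1 + z + 2zω and ρ = 2 + 3ω in ℤ[ω], let a be the largest natural number with ρ^a dividing α, and let β ∈ ℤ[ω] be such that α = ρ^a · β. Let b = N(β) be the norm of β. Assume that either a ≡ 1 (mod 3) and b ≡ ±1 (mod 7), or a ≡ 0 (mod 3) and b ≡ ±2 (mod 7). Then there exists a prime element p of ℤ[ω] dividing β such that the multiplicity e of p in β is not divisible by 3 and there is no t ∈ ℤ[ω] with p dividing t³ − 28 (i.e., 28 is not a cube modulo p). -/

import Mathlib

open Polynomial

/-- The ring of Eisenstein integers ℤ[ω] = ℤ[X]/(X² + X + 1). -/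
abbrev Eisenstein : Type := AdjoinRoot (X ^ 2 + X + 1 : ℤ[X])

/-- ω, a primitive cube root of unity, satisfying ω² + ω + 1 = 0. -/
noncomputable def ω : Eisenstein := AdjoinRoot.root _

lemma omega_prop : ω ^ 2 + ω + 1 = 0 := by
  have := AdjoinRoot.eval₂_root (X ^ 2 + X + 1 : ℤ[X])
  simp only [eval₂_add, eval₂_pow, eval₂_X, eval₂_one] at this
  simpa [ω] using this

/-- Complex conjugation on the Eisenstein integers, sending ω to ω² = -1 - ω. -/
noncomputable def conj : Eisenstein →+* Eisenstein :=
  AdjoinRoot.lift (Int.castRingHom Eisenstein) (-1 - ω) (by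
    simp only [eval₂_add, eval₂_pow, eval₂_X, eval₂_one]
    linear_combination omega_prop)


instance e_nz3 : NeZero ((3 : ℕ) : ℚ) := ⟨by norm_num⟩

instance e_cyc : @IsCyclotomicExtension {3} ℚ (CyclotomicField 3 ℚ) _ _ DivisionRing.toRatAlgebra := by
  have h := CyclotomicField.isCyclotomicExtension 3 ℚ
  convert h using 1
  · rfl
  · exact Subsingleton.elim _ _

instance e_fact2 : Fact (Nat.Prime 7) := ⟨by norm_num⟩

lemma e_monic : (X ^ 2 + X + 1 : ℤ[X]).Monic := by monicity!

lemma e_natDegree : (X ^ 2 + X + 1 : ℤ[X]).natDegree = 2 := by compute_degree!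

noncomputable def eEquiv : Eisenstein ≃ₐ[ℤ] NumberField.RingOfIntegers (CyclotomicField 3 ℚ) :=
  AdjoinRoot.equiv' (X ^ 2 + X + 1 : ℤ[X])
    (IsCyclotomicExtension.zeta_spec 3 ℚ (CyclotomicField 3 ℚ)).integralPowerBasis
    (by
      rw [IsPrimitiveRoot.integralPowerBasis_gen]
      have h := IsCyclotomicExtension.zeta_spec 3 ℚ (CyclotomicField 3 ℚ)
      have h2 : minpoly ℤ h.toInteger = cyclotomic 3 ℤ := by
        rw [Polynomial.cyclotomic_eq_minpoly h (by norm_num)]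
        rw [← minpoly.algebraMap_eq (B' := CyclotomicField 3 ℚ)
          (FaithfulSMul.algebraMap_injective _ _)]
        congr!
      rw [h2]
      simpa [Polynomial.cyclotomic_three] using omega_prop)
    (by
      rw [IsPrimitiveRoot.integralPowerBasis_gen]
      have h := (IsCyclotomicExtension.zeta_spec 3 ℚ (CyclotomicField 3 ℚ)).toInteger_isPrimitiveRoot
      have := h.isRoot_cyclotomic (by norm_num)
      simpa [Polynomial.cyclotomic_three] using this)

instance e_domain : IsDomain Eisenstein := eEquiv.toMulEquiv.isDomain _

instance e_pid : IsPrincipalIdealRing Eisenstein :=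
  haveI := IsCyclotomicExtension.Rat.three_pid (CyclotomicField 3 ℚ)
  IsPrincipalIdealRing.of_surjective eEquiv.symm.toRingEquiv.toRingHom eEquiv.symm.surjective

instance e_charZero : CharZero Eisenstein :=
  charZero_of_injective_ringHom (f := eEquiv.symm.toRingEquiv.toRingHom) eEquiv.symm.injective

instance e_free : Module.Free ℤ Eisenstein := e_monic.free_adjoinRoot

instance e_finite : Module.Finite ℤ Eisenstein := e_monic.finite_adjoinRoot

lemma e_finrank : Module.finrank ℤ Eisenstein = 2 := by
  rw [(AdjoinRoot.powerBasis' e_monic).finrank, AdjoinRoot.powerBasis'_dim, e_natDegree]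

lemma e_exists (x : Eisenstein) : ∃ m n : ℤ, x = m + n * ω := by
  induction x using AdjoinRoot.induction_on with
  | ih f =>
    induction f using Polynomial.induction_on' with
    | add p q hp hq =>
      obtain ⟨a, b, h⟩ := hp
      obtain ⟨c, d, h'⟩ := hq
      exact ⟨a + c, b + d, by rw [map_add, h, h']; push_cast; ring⟩
    | monomial k c =>
      induction k with
      | zero => exact ⟨c, 0, by simp⟩
      | succ k ih =>
        obtain ⟨a, b, h⟩ := ih
        refine ⟨-b, a - b, ?_⟩
        have : (monomial (k + 1) c : ℤ[X]) = monomial k c * X := by simp [monomial_mul_X]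
        rw [this, map_mul, h, AdjoinRoot.mk_X]
        change _ * ω = _
        push_cast
        linear_combination (b : Eisenstein) * omega_prop

/-- evaluation homs -/
noncomputable def eHom {R : Type*} [CommRing R] (r : R) (h : r ^ 2 + r + 1 = 0) :
    Eisenstein →+* R :=
  AdjoinRoot.lift (Int.castRingHom R) r (by simpa using h)

lemma eHom_omega {R : Type*} [CommRing R] (r : R) (h : r ^ 2 + r + 1 = 0) :
    eHom r h ω = r := by
  simp [eHom, ω]

lemma conj_omega : conj ω = -1 - ω := by
  conv_lhs => rw [ω]
  simp [conj]

lemma conj_conj (x : Eisenstein) : conj (conj x) = x := by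
  obtain ⟨m, n, rfl⟩ := e_exists x
  simp [conj_omega]

lemma conj_mul_self (m n : ℤ) :
    ((m : Eisenstein) + n * ω) * conj (m + n * ω) = ((m ^ 2 - m * n + n ^ 2 : ℤ) : Eisenstein) := by
  simp only [map_add, map_mul, map_intCast, conj_omega]
  push_cast
  linear_combination (-(n : Eisenstein) ^ 2) * omega_prop

lemma e_unit (x : Eisenstein) (hx : IsUnit x) :
    x = 1 ∨ x = -1 ∨ x = ω ∨ x = -ω ∨ x = 1 + ω ∨ x = -1 - ω := by
  obtain ⟨m, n, rfl⟩ := e_exists x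
  obtain ⟨y, hy⟩ := hx.exists_right_inv
  obtain ⟨k, l, rfl⟩ := e_exists y
  have h1 := conj_mul_self m n
  have h2 := conj_mul_self k l
  have h3 : (m ^ 2 - m * n + n ^ 2) * (k ^ 2 - k * l + l ^ 2) = 1 := by
    have : (((m ^ 2 - m * n + n ^ 2) * (k ^ 2 - k * l + l ^ 2) : ℤ) : Eisenstein) = (1 : ℤ) := by
      rw [Int.cast_mul, ← h1, ← h2, mul_mul_mul_comm, ← map_mul, hy]; simp
    exact_mod_cast this
  have h4 : m ^ 2 - m * n + n ^ 2 = 1 := by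
    rcases Int.eq_one_or_neg_one_of_mul_eq_one h3 with h | h
    · exact h
    · nlinarith [sq_nonneg (m - n), sq_nonneg m, sq_nonneg n]
  have hm : m ≤ 1 := by nlinarith [sq_nonneg (m - 2 * n)]
  have hm' : -1 ≤ m := by nlinarith [sq_nonneg (m - 2 * n)]
  have hn : n ≤ 1 := by nlinarith [sq_nonneg (n - 2 * m)]
  have hn' : -1 ≤ n := by nlinarith [sq_nonneg (n - 2 * m)]
  have key : (m = 1 ∧ n = 0) ∨ (m = -1 ∧ n = 0) ∨ (m = 0 ∧ n = 1) ∨ (m = 0 ∧ n = -1) ∨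
      (m = 1 ∧ n = 1) ∨ (m = -1 ∧ n = -1) := by
    interval_cases m <;> interval_cases n <;> simp_all
  rcases key with ⟨rfl, rfl⟩ | ⟨rfl, rfl⟩ | ⟨rfl, rfl⟩ | ⟨rfl, rfl⟩ | ⟨rfl, rfl⟩ | ⟨rfl, rfl⟩
  · left; simp
  · right; left; simp
  · right; right; left; simp
  · right; right; right; left; simp
  · right; right; right; right; left; simp
  · right; right; right; right; right; push_cast; ring

noncomputable def conjEquiv : Eisenstein ≃+* Eisenstein :=
  RingEquiv.ofRingHom conj conj (RingHom.ext conj_conj) (RingHom.ext conj_conj)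

lemma e_card (p : Eisenstein) :
    ((Nat.card (Eisenstein ⧸ Ideal.span {p}) : ℕ) : Eisenstein) = p * conj p := by
  obtain ⟨m, n, hmn⟩ := e_exists p
  have h := conj_mul_self m n
  rw [← hmn] at h
  have hpos : 0 ≤ m ^ 2 - m * n + n ^ 2 := by
    nlinarith [sq_nonneg (m - n), sq_nonneg m, sq_nonneg n]
  have hc : Ideal.absNorm (Ideal.span {conj p}) = Ideal.absNorm (Ideal.span {p}) := by
    rw [Ideal.absNorm_apply, Ideal.absNorm_apply, Submodule.cardQuot_apply,
      Submodule.cardQuot_apply]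
    refine (Nat.card_congr (Ideal.quotientEquiv _ _ conjEquiv ?_).toEquiv).symm
    rw [Ideal.map_span]
    simp [conjEquiv]
  have h2 : Ideal.absNorm (Ideal.span {p}) ^ 2 = (m ^ 2 - m * n + n ^ 2).natAbs ^ 2 := by
    calc _ = Ideal.absNorm (Ideal.span {p}) * Ideal.absNorm (Ideal.span {conj p}) := by
          rw [hc, sq]
      _ = Ideal.absNorm (Ideal.span {p * conj p}) := by
          rw [← map_mul, Ideal.span_singleton_mul_span_singleton]
      _ = _ := by
          rw [h, Ideal.absNorm_span_singleton]
          have := Algebra.norm_algebraMap_of_basis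
            (AdjoinRoot.powerBasis' e_monic).basis (m ^ 2 - m * n + n ^ 2)
          rw [eq_intCast] at this
          rw [Fintype.card_fin, AdjoinRoot.powerBasis'_dim, e_natDegree] at this
          rw [← Int.natAbs_pow, ← this]
          congr!
  have h3 := Nat.pow_left_injective (n := 2) (by norm_num) h2
  rw [h]
  change ((Ideal.absNorm (Ideal.span {p}) : ℕ) : Eisenstein) = _
  rw [h3]
  have : (((m ^ 2 - m * n + n ^ 2).natAbs : ℤ)) = m ^ 2 - m * n + n ^ 2 :=
    Int.natAbs_of_nonneg hpos
  conv_rhs => rw [← this]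
  simp

abbrev F4 : Type := QuadraticAlgebra (ZMod 2) 1 1

instance f4_fact : Fact (∀ r : ZMod 2, r ^ 2 ≠ 1 + 1 * r) := ⟨by decide⟩

instance f4_charP : CharP F4 2 :=
  charP_of_injective_algebraMap (algebraMap (ZMod 2) F4).injective 2

/-- The transfer of cube roots of unity from `F4` to `ZMod 7`. -/
def tFun : F4 → ZMod 7 := fun x =>
  if x.re = 0 then (if x.im = 0 then 0 else 4) else (if x.im = 0 then 1 else 2)

def tHom : F4 →* ZMod 7 where
  toFun := tFun
  map_one' := by decide
  map_mul' := by
    have h : ∀ a b c d : ZMod 2, tFun ((⟨a, b⟩ : F4) * ⟨c, d⟩) = tFun ⟨a, b⟩ * tFun ⟨c, d⟩ := by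
      decide
    rintro ⟨a, b⟩ ⟨c, d⟩
    exact h a b c d

noncomputable def uHom : Eisenstein →+* F4 := eHom ⟨0, 1⟩ (by decide)
noncomputable def sHom : Eisenstein →+* ZMod 7 := eHom 4 (by decide)
noncomputable def sHom' : Eisenstein →+* ZMod 7 := eHom 2 (by decide)

lemma uHom_omega : uHom ω = ⟨0, 1⟩ := eHom_omega _ _
lemma sHom_omega : sHom ω = 4 := eHom_omega _ _
lemma sHom'_omega : sHom' ω = 2 := eHom_omega _ _

lemma sHom_conj (x : Eisenstein) : sHom (conj x) = sHom' x := by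
  obtain ⟨m, n, rfl⟩ := e_exists x
  simp only [map_add, map_mul, map_intCast, conj_omega, map_sub, map_neg, map_one, sHom_omega,
    sHom'_omega]
  rw [show (-1 - 4 : ZMod 7) = 2 by decide]

lemma sHom'_conj (x : Eisenstein) : sHom' (conj x) = sHom x := by
  rw [← sHom_conj, conj_conj]

lemma uHom_apply (m n : ℤ) : uHom (m + n * ω) = ⟨m, n⟩ := by
  simp only [map_add, map_mul, map_intCast, uHom_omega]
  ext <;> simp

lemma tu_conj (x : Eisenstein) : tHom (uHom (conj x)) = tHom (uHom x) ^ 2 := by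
  obtain ⟨m, n, rfl⟩ := e_exists x
  have h : conj (m + n * ω) = ((m - n : ℤ) : Eisenstein) + ((-n : ℤ) : Eisenstein) * ω := by
    simp only [map_add, map_mul, map_intCast, conj_omega]
    push_cast; ring
  rw [h, uHom_apply, uHom_apply]
  push_cast
  generalize (m : ZMod 2) = a
  generalize (n : ZMod 2) = b
  revert a b
  decide

/-- The cubic character of conductor 14 attached to `28`, with values in `ZMod 7`. -/
noncomputable def fChar (x : Eisenstein) : ZMod 7 :=
  tHom (uHom x) ^ 2 * sHom x ^ 2 * sHom' x ^ 4

lemma fChar_mul (x y : Eisenstein) : fChar (x * y) = fChar x * fChar y := by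
  simp only [fChar, map_mul]; ring

lemma fChar_one : fChar 1 = 1 := by simp [fChar]

lemma fChar_pow (x : Eisenstein) (n : ℕ) : fChar (x ^ n) = fChar x ^ n := by
  simp only [fChar, map_pow]; ring

lemma fChar_conj (x : Eisenstein) : fChar (conj x) = fChar x ^ 2 := by
  simp only [fChar, tu_conj, sHom_conj, sHom'_conj]
  have h : sHom' x ^ 7 = sHom' x := ZMod.pow_card _
  linear_combination -(tHom (uHom x) ^ 4 * sHom x ^ 4 * sHom' x) * h

lemma fChar_unit (x : Eisenstein) (hx : IsUnit x) : fChar x = 1 := by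
  have hw : fChar ω = 1 := by
    rw [fChar, uHom_omega, sHom_omega, sHom'_omega]; decide
  have hn : fChar (-1) = 1 := by
    simp only [fChar, map_neg, map_one]; decide
  have hc : fChar (-1 - ω) = 1 := by rw [← conj_omega, fChar_conj, hw]; simp
  rcases e_unit x hx with rfl | rfl | rfl | rfl | rfl | rfl
  · exact fChar_one
  · exact hn
  · exact hw
  · rw [← neg_one_mul, fChar_mul, hw, hn, one_mul]
  · rw [show (1 + ω : Eisenstein) = -1 * (-1 - ω) by ring, fChar_mul, hc, hn, one_mul]
  · exact hc

lemma fChar_cube (x : Eisenstein) (hx : IsCoprime x 42) : fChar x ^ 3 = 1 := by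
  obtain ⟨c, d, h⟩ := hx
  have h1 : sHom x ≠ 0 := by
    intro h0
    have := congrArg sHom h
    rw [map_add, map_mul, map_mul, h0, map_ofNat, show (42 : ZMod 7) = 0 by decide] at this
    simp at this
  have h2 : sHom' x ≠ 0 := by
    intro h0
    have := congrArg sHom' h
    rw [map_add, map_mul, map_mul, h0, map_ofNat, show (42 : ZMod 7) = 0 by decide] at this
    simp at this
  have h3 : uHom x ≠ 0 := by
    intro h0
    have := congrArg uHom h
    rw [map_add, map_mul, map_mul, h0, map_ofNat, show (42 : F4) = 0 by decide] at this
    simp at this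
  have h4 : tHom (uHom x) ≠ 0 := by
    intro h0
    have h5 := tHom.map_mul (uHom x) (uHom x)⁻¹
    rw [mul_inv_cancel₀ h3, h0] at h5
    simp at h5
  have e1 := ZMod.pow_card_sub_one_eq_one h1
  have e2 := ZMod.pow_card_sub_one_eq_one h2
  have e4 := ZMod.pow_card_sub_one_eq_one h4
  norm_num at e1 e2 e4
  calc fChar x ^ 3 = tHom (uHom x) ^ 6 * sHom x ^ 6 * (sHom' x ^ 6) ^ 2 := by
        rw [fChar]; ring
    _ = 1 := by rw [e1, e2, e4]; simp

lemma gauss_key {F K : Type*} [Field F] [Fintype F] [Field K] (q : ℕ) [Fact q.Prime] [CharP K q]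
    (hne : (q : F) ≠ 0) (χ : MulChar F K) (hχ : orderOf χ = 3) (k n : ℕ) (hk : q ^ k = 3 * n + 1) :
    χ ((q : F) ^ k) * (Fintype.card F * jacobiSum χ χ) ^ n = 1 := by
  have hchar : ringChar K ≠ ringChar F := by
    rw [ringChar.eq K q]
    intro h
    exact hne ((ringChar.spec F q).2 (by rw [← h]))
  obtain ⟨N, ψ, hψ⟩ := AddChar.FiniteField.primitiveChar F K hchar
  set K' := CyclotomicField N K
  have : CharP K' q := charP_of_injective_algebraMap (algebraMap K K').injective q
  set χ' := χ.ringHomComp (algebraMap K K') with hχ'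
  have ho : orderOf χ' = 3 := by
    apply orderOf_eq_prime
    · rw [hχ', MulChar.ringHomComp_pow, ← hχ, pow_orderOf_eq_one, MulChar.ringHomComp_one]
    · rw [hχ', MulChar.ringHomComp_ne_one_iff (algebraMap K K').injective]
      intro h
      rw [h, orderOf_one] at hχ
      omega
  have h3 : χ' ^ 3 = 1 := by rw [← ho]; exact pow_orderOf_eq_one _
  have h1 : χ' ≠ 1 := by
    intro h
    rw [h, orderOf_one] at ho
    omega
  have hm1 : χ' (-1) = 1 := by
    have a1 : χ' (-1) ^ 3 = 1 := by
      rw [← MulChar.pow_apply' _ (by norm_num), h3, MulChar.one_apply (by simp)]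
    have a2 : χ' (-1) ^ 2 = 1 := by
      rw [← map_pow]; simp
    calc χ' (-1) = χ' (-1) * χ' (-1) ^ 2 := by rw [a2, mul_one]
      _ = 1 := by rw [← pow_succ', a1]
  have hg := gaussSum_pow_eq_prod_jacobiSum (χ := χ') (by omega) hψ
  rw [ho, hm1] at hg
  simp only [Nat.Ico_succ_singleton, Finset.prod_singleton, pow_one,
    one_mul, show (3 - 1 : ℕ) = 1 + 1 from rfl] at hg
  have hfrob : ∀ k : ℕ, gaussSum χ' ψ ^ q ^ k = gaussSum (χ' ^ q ^ k) (ψ ^ q ^ k) := by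
    intro k
    induction k with
    | zero => simp
    | succ k ih => rw [pow_succ, pow_mul, ih, gaussSum_frob q, ← pow_mul, ← pow_mul]
  have hf := hfrob k
  have hpow : χ' ^ q ^ k = χ' := by rw [hk, pow_succ, pow_mul, h3, one_pow, one_mul]
  rw [hpow, AddChar.pow_mulShift] at hf
  have hcard : (Fintype.card F : K') ≠ 0 := by
    obtain ⟨n, hp, hc⟩ := FiniteField.card F (ringChar F)
    rw [hc]
    push_cast
    refine pow_ne_zero _ fun h0 => ?_
    rw [CharP.cast_eq_zero_iff K' q] at h0
    have := (Nat.prime_dvd_prime_iff_eq (Fact.out : q.Prime) hp).1 h0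
    exact hne ((ringChar.spec F q).2 (by rw [← this]))
  have hg0 := gaussSum_ne_zero_of_nontrivial hcard h1 hψ
  have hu := gaussSum_mulShift χ' ψ (Units.mk0 (((q ^ k : ℕ)) : F) (by push_cast; exact pow_ne_zero _ hne))
  rw [Units.val_mk0, ← hf, hk, pow_succ, pow_mul, hg, ← mul_assoc] at hu
  have hu2 := mul_right_cancel₀ hg0 (hu.trans (one_mul _).symm)
  rw [jacobiSum_ringHomComp, ← hk] at hu2
  apply (algebraMap K K').injective
  push_cast at hu2
  simpa [hχ', MulChar.ringHomComp_apply] using hu2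

lemma omega_ne_one : ω ≠ 1 := by
  intro h
  have := congrArg sHom h
  rw [sHom_omega, map_one] at this
  revert this
  decide

lemma omega_cube : ω ^ 3 = 1 := by
  linear_combination (ω - 1) * omega_prop

lemma omega_primitive : IsPrimitiveRoot ω 3 := by
  have : orderOf ω = 3 := orderOf_eq_prime omega_cube omega_ne_one
  rw [← this]
  exact IsPrimitiveRoot.orderOf _

lemma cube_root_cases (x : Eisenstein) (hx : x ^ 3 = 1) : x = 1 ∨ x = ω ∨ x = ω ^ 2 := by
  have h : (x - 1) * ((x - ω) * (x - ω ^ 2)) = 0 := by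
    linear_combination hx + (-x ^ 2 + x * ω) * omega_prop - omega_cube
  rcases mul_eq_zero.1 h with h | h
  · exact Or.inl (sub_eq_zero.1 h)
  · rcases mul_eq_zero.1 h with h | h
    · exact Or.inr (Or.inl (sub_eq_zero.1 h))
    · exact Or.inr (Or.inr (sub_eq_zero.1 h))

lemma conj_mul_of_cube (x : Eisenstein) (hx : x ^ 3 = 1) : conj x * x = 1 := by
  rcases cube_root_cases x hx with rfl | rfl | rfl
  · simp
  · rw [conj_omega]; linear_combination -omega_prop
  · rw [map_pow, conj_omega]; linear_combination (ω ^ 2 + ω - 1) * omega_prop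

lemma t_of_u (x y : Eisenstein) (hx : x ^ 3 = 1) (h : uHom x * uHom y = 1) :
    sHom x * tHom (uHom y) = 1 := by
  have h1 : tHom (uHom x) = sHom x := by
    rcases cube_root_cases x hx with rfl | rfl | rfl
    · simp
    · rw [uHom_omega, sHom_omega]; decide
    · rw [map_pow, map_pow, map_pow, uHom_omega, sHom_omega]; decide
  rw [← h1, ← map_mul, h, map_one]



lemma chi_cube {F : Type*} [Field F] [Fintype F] (χ : MulChar F Eisenstein) (hχ : orderOf χ = 3)
    (x : F) (hx : x ≠ 0) : χ x ^ 3 = 1 := by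
  rw [← MulChar.pow_apply' _ (by norm_num), ← hχ, pow_orderOf_eq_one,
    MulChar.one_apply (IsUnit.mk0 x hx)]

lemma chi_ne_one {F : Type*} [Field F] [Fintype F] (χ : MulChar F Eisenstein)
    (hχ : orderOf χ = 3) : χ ≠ 1 := by
  intro h
  rw [h, orderOf_one] at hχ
  omega

lemma chi_order {F K : Type*} [Field F] [Fintype F] [Field K] (χ : MulChar F Eisenstein)
    (hχ : orderOf χ = 3) (φ : Eisenstein →+* K) (hφ : φ ω ≠ 1) :
    orderOf (χ.ringHomComp φ) = 3 := by
  apply orderOf_eq_prime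
  · rw [MulChar.ringHomComp_pow, ← hχ, pow_orderOf_eq_one, MulChar.ringHomComp_one]
  · intro h
    apply chi_ne_one χ hχ
    ext x
    have h1 : φ (χ x) = 1 := by
      rw [← MulChar.ringHomComp_apply, h, MulChar.one_apply x.isUnit]
    rw [MulChar.one_apply x.isUnit]
    rcases cube_root_cases _ (chi_cube χ hχ x x.ne_zero) with h2 | h2 | h2
    · exact h2
    · rw [h2] at h1; exact absurd h1 hφ
    · exfalso
      rw [h2, map_pow] at h1
      apply hφ
      have h3 : φ ω ^ 3 = 1 := by rw [← map_pow, omega_cube, map_one]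
      rwa [pow_succ, h1, one_mul] at h3

lemma chi_inv {F : Type*} [Field F] [Fintype F] (χ : MulChar F Eisenstein)
    (hχ : orderOf χ = 3) : χ.ringHomComp conj = χ⁻¹ := by
  apply eq_inv_of_mul_eq_one_left
  ext x
  rw [MulChar.one_apply x.isUnit, MulChar.mul_apply, MulChar.ringHomComp_apply]
  exact conj_mul_of_cube _ (chi_cube χ hχ x x.ne_zero)

lemma jacobi_norm {F : Type*} [Field F] [Fintype F] (χ : MulChar F Eisenstein)
    (hχ : orderOf χ = 3) :
    jacobiSum χ χ * conj (jacobiSum χ χ) = (Fintype.card F : Eisenstein) := by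
  rw [← jacobiSum_ringHomComp, chi_inv χ hχ]
  have hinj := IsFractionRing.injective Eisenstein (FractionRing Eisenstein)
  apply hinj
  rw [map_mul, ← jacobiSum_ringHomComp, ← jacobiSum_ringHomComp, ← MulChar.ringHomComp_inv,
    map_natCast]
  have : CharZero (FractionRing Eisenstein) := charZero_of_injective_ringHom hinj
  apply jacobiSum_mul_jacobiSum_inv
  · rw [ringChar.eq_zero]
    exact (CharP.ringChar_ne_zero_of_finite F).symm
  · exact (MulChar.ringHomComp_ne_one_iff hinj).2 (chi_ne_one χ hχ)
  · exact (MulChar.ringHomComp_ne_one_iff hinj).2 (chi_ne_one χ hχ)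
  · rw [← MulChar.ringHomComp_mul, MulChar.ringHomComp_ne_one_iff hinj]
    intro h
    have : orderOf χ ∣ 2 := orderOf_dvd_of_pow_eq_one ((sq χ).trans h)
    rw [hχ] at this
    omega

lemma jacobi_char {F : Type*} [Field F] [Fintype F] (χ : MulChar F Eisenstein)
    (hχ : orderOf χ = 3) (h2 : (2 : F) ≠ 0) (h7 : (7 : F) ≠ 0) :
    fChar (jacobiSum χ χ) = sHom (χ 28) := by
  set J := jacobiSum χ χ with hJ
  have hN := jacobi_norm χ hχ
  rw [← hJ] at hN
  have k7 := gauss_key 7 (by exact_mod_cast h7) (χ.ringHomComp sHom)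
    (chi_order χ hχ sHom (by rw [sHom_omega]; decide)) 1 2 (by norm_num)
  have k2 := gauss_key 2 (by exact_mod_cast h2) (χ.ringHomComp uHom)
    (chi_order χ hχ uHom (by rw [uHom_omega]; decide)) 2 1 (by norm_num)
  rw [jacobiSum_ringHomComp, MulChar.ringHomComp_apply, ← hJ, ← map_natCast sHom, ← hN, map_mul,
    sHom_conj] at k7
  rw [jacobiSum_ringHomComp, MulChar.ringHomComp_apply, ← hJ] at k2
  have hcard : ((Fintype.card F : ℕ) : F4) = 1 := by
    have hz : ((Fintype.card F : ℕ) : F4) ≠ 0 := by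
      intro h0
      rw [h0] at k2
      simp at k2
    have : ∀ n : ℕ, (n : F4) = 0 ∨ (n : F4) = 1 := by
      intro n
      induction n with
      | zero => simp
      | succ n ih =>
        rcases ih with h | h
        · right; simp [h]
        · left; push_cast; rw [h]; decide
    exact (this _).resolve_left hz
  rw [hcard, one_mul, pow_one] at k2
  have c4 : χ ((2 : F) ^ 2) ^ 3 = 1 := chi_cube χ hχ _ (pow_ne_zero _ h2)
  have k2' := t_of_u (χ ((2 : F) ^ 2)) J c4 (by exact_mod_cast k2)
  rw [show (28 : F) = 2 ^ 2 * 7 by norm_num, map_mul, map_mul]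
  have c4' : sHom (χ ((2 : F) ^ 2)) ^ 3 = 1 := by rw [← map_pow, c4, map_one]
  norm_num only [pow_one, Nat.cast_ofNat] at k7
  rw [fChar]
  have hs : sHom J ≠ 0 := by intro h; rw [h] at k7; simp at k7
  have hs' : sHom' J ≠ 0 := by intro h; rw [h] at k7; simp at k7
  have e1 := ZMod.pow_card_sub_one_eq_one hs
  have e2 := ZMod.pow_card_sub_one_eq_one hs'
  norm_num only at e1 e2
  generalize sHom (χ ((2 : F) ^ 2)) = c at *
  generalize sHom (χ 7) = d at *
  generalize tHom (uHom J) = T at *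
  generalize sHom J = s at *
  generalize sHom' J = s' at *
  have hT : T ^ 2 = c := by
    calc T ^ 2 = c ^ 3 * T ^ 2 := by rw [c4', one_mul]
      _ = c * (c * T) ^ 2 := by ring
      _ = c := by rw [k2']; ring
  have hd : s ^ 2 * s' ^ 4 = d := by
    calc s ^ 2 * s' ^ 4 = s ^ 2 * s' ^ 4 * (d * (s * s' * s) ^ 2) := by rw [k7, mul_one]
      _ = d * (s ^ 6 * s' ^ 6) := by ring
      _ = d := by rw [e1, e2]; ring
  rw [mul_assoc, hT, hd]


lemma prime_key (p : Eisenstein) (hp : Prime p) (hcop : IsCoprime p 42) (t : Eisenstein)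
    (ht : p ∣ t ^ 3 - 28) : fChar p = 1 := by
  have hmax : (Ideal.span {p}).IsMaximal := PrincipalIdealRing.isMaximal_of_irreducible hp.irreducible
  let _ : Field (Eisenstein ⧸ Ideal.span {p}) := Ideal.Quotient.field _
  have hcard := e_card p
  have hcp : conj p ≠ 0 := by
    intro h
    apply hp.ne_zero
    rw [← conj_conj p, h, map_zero]
  have hfin : Finite (Eisenstein ⧸ Ideal.span {p}) := by
    apply Nat.finite_of_card_ne_zero
    intro h
    rw [h] at hcard
    exact mul_ne_zero hp.ne_zero hcp (by simpa using hcard.symm)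
  let _ : Fintype (Eisenstein ⧸ Ideal.span {p}) := Fintype.ofFinite _
  classical
  rw [Nat.card_eq_fintype_card] at hcard
  set π := Ideal.Quotient.mk (Ideal.span {p}) with hπ
  have hmk : ∀ x, π x = 0 ↔ p ∣ x := fun x => by
    rw [hπ, Ideal.Quotient.eq_zero_iff_mem, Ideal.mem_span_singleton]
  have h42 : (42 : Eisenstein ⧸ Ideal.span {p}) ≠ 0 := by
    intro h
    have : π 42 = 0 := by rw [map_ofNat]; exact h
    exact hp.not_isUnit (hcop.isUnit_of_dvd' dvd_rfl ((hmk _).1 this))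
  have h2 : (2 : Eisenstein ⧸ Ideal.span {p}) ≠ 0 := by
    intro h; apply h42; linear_combination 21 * h
  have h3 : (3 : Eisenstein ⧸ Ideal.span {p}) ≠ 0 := by
    intro h; apply h42; linear_combination 14 * h
  have h7 : (7 : Eisenstein ⧸ Ideal.span {p}) ≠ 0 := by
    intro h; apply h42; linear_combination 6 * h
  have hdvd : 3 ∣ Fintype.card (Eisenstein ⧸ Ideal.span {p}) - 1 := by
    have hw3 : π ω ^ 3 = 1 := by rw [← map_pow, omega_cube, map_one]
    have hw1 : π ω ≠ 1 := by
      intro h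
      have := congrArg π omega_prop
      rw [map_add, map_add, map_pow, h, map_one, map_zero] at this
      apply h3
      linear_combination this
    have hw0 : π ω ≠ 0 := by intro h; rw [h] at hw3; simp at hw3
    have ho : orderOf (Units.mk0 (π ω) hw0) = 3 := by
      apply orderOf_eq_prime
      · ext; simpa using hw3
      · intro h; apply hw1; simpa using congrArg Units.val h
    rw [← Fintype.card_units, ← ho]
    exact orderOf_dvd_card
  obtain ⟨χ, hχ⟩ := MulChar.exists_mulChar_orderOf (Eisenstein ⧸ Ideal.span {p}) hdvd
    omega_primitive
  have hJ := jacobi_char χ hχ h2 h7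
  have hN := jacobi_norm χ hχ
  rw [hcard] at hN
  have ht' : (28 : Eisenstein ⧸ Ideal.span {p}) = π t ^ 3 := by
    have := (hmk _).2 ht
    rw [map_sub, map_pow, map_ofNat] at this
    exact (sub_eq_zero.1 this).symm
  have ht0 : π t ≠ 0 := by
    intro h
    rw [h] at ht'
    have : (2 : Eisenstein ⧸ Ideal.span {p}) * 2 * 7 = 0 := by
      linear_combination ht'
    exact mul_ne_zero (mul_ne_zero h2 h2) h7 this
  rw [ht', map_pow, chi_cube χ hχ _ ht0, map_one] at hJ
  set J := jacobiSum χ χ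
  -- any `x` with norm equal to that of `p`, divisible by `p`, is associated to `p`
  have key : ∀ x, x * conj x = p * conj p → p ∣ x → fChar x = 1 → fChar p = 1 := by
    rintro x hx ⟨k, rfl⟩ hf
    have hk : k * conj k = 1 := by
      apply mul_left_cancel₀ (mul_ne_zero hp.ne_zero hcp)
      rw [map_mul] at hx
      linear_combination hx
    rwa [fChar_mul, fChar_unit k (IsUnit.of_mul_eq_one _ hk), mul_one] at hf
  have hpd : p ∣ J * conj J := ⟨conj p, hN⟩
  rcases hp.dvd_or_dvd hpd with h | h
  · exact key J hN h hJ
  · refine key (conj J) ?_ h ?_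
    · rw [conj_conj, mul_comm, hN]
    · rw [fChar_conj, hJ, one_pow]

lemma fChar_eq_one (β : Eisenstein) (hcop : IsCoprime β 42)
    (h : ∀ p : Eisenstein, Prime p → p ∣ β →
      (∃ e : ℕ, p ^ e ∣ β ∧ ¬ p ^ (e + 1) ∣ β ∧ ¬ (3 ∣ e)) → ∃ t : Eisenstein, p ∣ t ^ 3 - 28) :
    fChar β = 1 := by
  induction β using UniqueFactorizationMonoid.induction_on_coprime with
  | h0 =>
    have := (isCoprime_zero_left.1 hcop).map sHom
    rw [map_ofNat, show (42 : ZMod 7) = 0 by decide] at this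
    simp at this
  | h1 hx => exact fChar_unit _ hx
  | hpr i hp =>
    rename_i p
    rw [fChar_pow]
    rcases Nat.eq_zero_or_pos i with rfl | hi
    · simp
    have hpc : IsCoprime p 42 := (IsCoprime.pow_left_iff hi).1 hcop
    by_cases h3 : 3 ∣ i
    · obtain ⟨k, rfl⟩ := h3
      rw [pow_mul, fChar_cube p hpc, one_pow]
    · obtain ⟨t, ht⟩ := h p hp (dvd_pow_self _ hi.ne') ⟨i, dvd_rfl, by
        rw [pow_dvd_pow_iff hp.ne_zero hp.not_isUnit]; omega, h3⟩
      rw [prime_key p hp hpc t ht, one_pow]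
  | hcp hxy ihx ihy =>
    rename_i x y
    rw [fChar_mul]
    have aux : ∀ x y : Eisenstein, IsRelPrime x y →
        (∀ p : Eisenstein, Prime p → p ∣ x * y →
      (∃ e : ℕ, p ^ e ∣ x * y ∧ ¬ p ^ (e + 1) ∣ x * y ∧ ¬ (3 ∣ e)) →
        ∃ t : Eisenstein, p ∣ t ^ 3 - 28) →
        ∀ p : Eisenstein, Prime p → p ∣ x →
      (∃ e : ℕ, p ^ e ∣ x ∧ ¬ p ^ (e + 1) ∣ x ∧ ¬ (3 ∣ e)) →
        ∃ t : Eisenstein, p ∣ t ^ 3 - 28 := by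
      rintro x y hxy h p hp hpx ⟨e, he1, he2, he3⟩
      refine h p hp (hpx.mul_right _) ⟨e, he1.mul_right _, fun hd => he2 ?_, he3⟩
      exact hp.pow_dvd_of_dvd_mul_right _ (fun hy => hp.not_isUnit (hxy hpx hy)) hd
    rw [ihx hcop.of_mul_left_left (aux x y hxy h),
      ihy hcop.of_mul_left_right (aux y x hxy.symm (by rwa [mul_comm y x])), one_mul]

theorem exists_prime_with_bad_multiplicity (z : ℤ) (hz2 : Even z)
    (hz7 : z ≡ 3 [ZMOD 7])
    (a : ℕ)
    (ha : ((2 : Eisenstein) + 3 * ω) ^ a ∣ (1 + (z : Eisenstein) + 2 * (z : Eisenstein) * ω) ∧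
      ¬ ((2 : Eisenstein) + 3 * ω) ^ (a + 1) ∣ (1 + (z : Eisenstein) + 2 * (z : Eisenstein) * ω))
    (β : Eisenstein)
    (hβ : (1 + (z : Eisenstein) + 2 * (z : Eisenstein) * ω) = ((2 : Eisenstein) + 3 * ω) ^ a * β)
    (b : ℤ) (hb : (b : Eisenstein) = β * conj β)
    (hcase : (a % 3 = 1 ∧ (b ≡ 1 [ZMOD 7] ∨ b ≡ -1 [ZMOD 7])) ∨
      (a % 3 = 0 ∧ (b ≡ 2 [ZMOD 7] ∨ b ≡ -2 [ZMOD 7]))) :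
    ∃ p : Eisenstein, Prime p ∧ p ∣ β ∧
      (∃ e : ℕ, p ^ e ∣ β ∧ ¬ p ^ (e + 1) ∣ β ∧ ¬ (3 ∣ e)) ∧
      ¬ ∃ t : Eisenstein, p ∣ t ^ 3 - 28 := by
  have hα7 : sHom' (1 + (z : Eisenstein) + 2 * (z : Eisenstein) * ω) = 2 := by
    have hz : ((z : ℤ) : ZMod 7) = ((3 : ℤ) : ZMod 7) := (ZMod.intCast_eq_intCast_iff _ _ 7).2 hz7
    simp only [map_add, map_mul, map_intCast, map_one, map_ofNat, sHom'_omega, hz]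
    decide
  have hα2 : uHom (1 + (z : Eisenstein) + 2 * (z : Eisenstein) * ω) = 1 := by
    have hz : ((z : ℤ) : F4) = 0 := by
      obtain ⟨w, rfl⟩ := hz2
      rw [← two_mul]
      push_cast
      rw [show (2 : F4) = 0 by decide, zero_mul]
    simp only [map_add, map_mul, map_intCast, map_one, hz]
    simp
  rw [hβ, map_mul, map_pow] at hα7 hα2
  have hρ' : sHom' (2 + 3 * ω) = 1 := by
    simp only [map_add, map_mul, map_ofNat, sHom'_omega]; decide
  have hρ2 : uHom (2 + 3 * ω) = ⟨0, 1⟩ := by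
    simp only [map_add, map_mul, map_ofNat, uHom_omega]; decide
  rw [hρ', one_pow, one_mul] at hα7
  rw [hρ2] at hα2
  have ht := congrArg tHom hα2
  rw [map_mul, map_pow, map_one, show tHom ⟨0, 1⟩ = 4 by decide] at ht
  have hs := congrArg sHom hb
  rw [map_mul, sHom_conj, hα7, map_intCast] at hs
  -- coprimality
  have hcop : IsCoprime β 42 := by
    have h6 : IsCoprime β 6 := by
      have hd : β ∣ (1 + (z : Eisenstein) + 2 * (z : Eisenstein) * ω) := ⟨_, hβ.trans (mul_comm _ _)⟩
      apply IsCoprime.of_isCoprime_of_dvd_left _ hd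
      obtain ⟨w, rfl⟩ := hz2
      refine ⟨1 + ((w + w : ℤ) : Eisenstein) + 2 * ((w + w : ℤ) : Eisenstein) * (-1 - ω),
        -2 * (w : Eisenstein) ^ 2, ?_⟩
      push_cast
      linear_combination (-16 * (w : Eisenstein) ^ 2) * omega_prop
    have h7 : IsCoprime β 7 := by
      have hb7 : IsCoprime b 7 := by
        rw [isCoprime_comm, Prime.coprime_iff_not_dvd (by norm_num)]
        intro h
        have h0 : b % 7 = 0 := Int.emod_eq_zero_of_dvd h
        simp only [Int.ModEq] at hcase
        omega
      have := hb7.map (Int.castRingHom Eisenstein)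
      simp only [eq_intCast, hb] at this
      exact IsCoprime.of_mul_left_left (by simpa using this)
    have := h6.mul_right h7
    norm_num at this
    exact this
  have hf : fChar β ≠ 1 := by
    have ha3 : (4 : ZMod 7) ^ a = 4 ^ (a % 3) := by
      conv_lhs => rw [← Nat.div_add_mod a 3, pow_add, pow_mul,
        show (4 : ZMod 7) ^ 3 = 1 by decide, one_pow, one_mul]
    rw [ha3] at ht
    rw [fChar, hα7]
    generalize tHom (uHom β) = T at *
    generalize sHom β = s at *
    have hbb : ∀ c : ℤ, b ≡ c [ZMOD 7] → (b : ZMod 7) = c :=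
      fun c hc => (ZMod.intCast_eq_intCast_iff _ _ 7).2 hc
    rcases hcase with ⟨h1, h2 | h2⟩ | ⟨h1, h2 | h2⟩ <;>
    · rw [h1] at ht
      rw [hbb _ h2] at hs
      clear * - ht hs
      revert T s
      decide
  by_contra hcon
  apply hf
  push Not at hcon
  exact fChar_eq_one β hcop hcon
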